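/- Let n ≥ 1 be an integer and ζ a real transcendental number with λ_n(ζ) and w_n(ζ) finite, and assume equality holds in the right Khintchine transference inequality, i.e. n·λ_n(ζ) + n − 1 = w_n(ζ). Then λ̂_n(ζ) = 1/n and ŵ_n(ζ) = n. -/

import Mathlib

open Polynomial

/-- Height of an integer polynomial: the maximum absolute value of its coefficients. -/
noncomputable def polyH (P : Polynomial ℤ) : ℝ :=
  (((P.support.sup fun i => (P.coeff i).natAbs) : ℕ) : ℝ)

/-- Evaluation of an integer polynomial at a real number. -/
noncomputable def pev (ζ : ℝ) (P : Polynomial ℤ) : ℝ := Polynomial.aeval ζ P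

/-- Set of exponents η such that for arbitrarily large X the system
    H(P) ≤ X, 0 < |P(ζ)| ≤ X^(−η) has a solution of degree at most n. -/
def wSet (n : ℕ) (ζ : ℝ) : Set ℝ :=
  {η | ∀ X₀ : ℝ, ∃ X : ℝ, X₀ ≤ X ∧ ∃ P : Polynomial ℤ,
    P.natDegree ≤ n ∧ polyH P ≤ X ∧ 0 < |pev ζ P| ∧ |pev ζ P| ≤ X ^ (-η)}

/-- The exponent w_n(ζ). -/
noncomputable def wExp (n : ℕ) (ζ : ℝ) : ℝ := sSup (wSet n ζ)

/-- Set of exponents η such that for all sufficiently large X the system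
    H(P) ≤ X, 0 < |P(ζ)| ≤ X^(−η) has a solution of degree at most n. -/
def whSet (n : ℕ) (ζ : ℝ) : Set ℝ :=
  {η | ∃ X₀ : ℝ, ∀ X : ℝ, X₀ ≤ X → ∃ P : Polynomial ℤ,
    P.natDegree ≤ n ∧ polyH P ≤ X ∧ 0 < |pev ζ P| ∧ |pev ζ P| ≤ X ^ (-η)}

/-- The uniform exponent ŵ_n(ζ). -/
noncomputable def whExp (n : ℕ) (ζ : ℝ) : ℝ := sSup (whSet n ζ)

/-- Set of exponents η such that for arbitrarily large X the system
    |x| ≤ X, max_{1≤i≤n} |ζ^i x − y_i| ≤ X^(−η) has a nonzero integer solution. -/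
def lamSet (n : ℕ) (ζ : ℝ) : Set ℝ :=
  {η | ∀ X₀ : ℝ, ∃ X : ℝ, X₀ ≤ X ∧ ∃ x : ℤ, ∃ y : Fin n → ℤ,
    (x ≠ 0 ∨ y ≠ 0) ∧ ((|x| : ℤ) : ℝ) ≤ X ∧
    ∀ i : Fin n, |ζ ^ ((i : ℕ) + 1) * (x : ℝ) - (y i : ℝ)| ≤ X ^ (-η)}

/-- The exponent λ_n(ζ). -/
noncomputable def lamExp (n : ℕ) (ζ : ℝ) : ℝ := sSup (lamSet n ζ)

/-- Set of exponents η such that for all sufficiently large X the system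
    |x| ≤ X, max_{1≤i≤n} |ζ^i x − y_i| ≤ X^(−η) has a nonzero integer solution. -/
def lamhSet (n : ℕ) (ζ : ℝ) : Set ℝ :=
  {η | ∃ X₀ : ℝ, ∀ X : ℝ, X₀ ≤ X → ∃ x : ℤ, ∃ y : Fin n → ℤ,
    (x ≠ 0 ∨ y ≠ 0) ∧ ((|x| : ℤ) : ℝ) ≤ X ∧
    ∀ i : Fin n, |ζ ^ ((i : ℕ) + 1) * (x : ℝ) - (y i : ℝ)| ≤ X ^ (-η)}

/-- The uniform exponent λ̂_n(ζ). -/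
noncomputable def lamhExp (n : ℕ) (ζ : ℝ) : ℝ := sSup (lamhSet n ζ)

/-- Set of exponents η such that for arbitrarily large X the polynomial system has
    at least j linearly independent solutions of degree at most n. -/
def wSetJ (n j : ℕ) (ζ : ℝ) : Set ℝ :=
  {η | ∀ X₀ : ℝ, ∃ X : ℝ, X₀ ≤ X ∧ ∃ P : Fin j → Polynomial ℤ,
    LinearIndependent ℤ P ∧ ∀ i : Fin j,
      (P i).natDegree ≤ n ∧ polyH (P i) ≤ X ∧ 0 < |pev ζ (P i)| ∧ |pev ζ (P i)| ≤ X ^ (-η)}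

/-- The exponent w_{n,j}(ζ). -/
noncomputable def wExpJ (n j : ℕ) (ζ : ℝ) : ℝ := sSup (wSetJ n j ζ)

/-- Set of exponents η such that for all sufficiently large X the polynomial system has
    at least j linearly independent solutions of degree at most n. -/
def whSetJ (n j : ℕ) (ζ : ℝ) : Set ℝ :=
  {η | ∃ X₀ : ℝ, ∀ X : ℝ, X₀ ≤ X → ∃ P : Fin j → Polynomial ℤ,
    LinearIndependent ℤ P ∧ ∀ i : Fin j,
      (P i).natDegree ≤ n ∧ polyH (P i) ≤ X ∧ 0 < |pev ζ (P i)| ∧ |pev ζ (P i)| ≤ X ^ (-η)}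

/-- The uniform exponent ŵ_{n,j}(ζ). -/
noncomputable def whExpJ (n j : ℕ) (ζ : ℝ) : ℝ := sSup (whSetJ n j ζ)

/-- Set of exponents η such that for arbitrarily large X the simultaneous approximation
    system has at least j linearly independent integer vector solutions. -/
def lamSetJ (n j : ℕ) (ζ : ℝ) : Set ℝ :=
  {η | ∀ X₀ : ℝ, ∃ X : ℝ, X₀ ≤ X ∧ ∃ v : Fin j → (Fin (n + 1) → ℤ),
    LinearIndependent ℤ v ∧ ∀ i : Fin j,
      ((|v i 0| : ℤ) : ℝ) ≤ X ∧
      ∀ t : Fin n, |ζ ^ ((t : ℕ) + 1) * ((v i 0 : ℤ) : ℝ) - ((v i t.succ : ℤ) : ℝ)| ≤ X ^ (-η)}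

/-- The exponent λ_{n,j}(ζ). -/
noncomputable def lamExpJ (n j : ℕ) (ζ : ℝ) : ℝ := sSup (lamSetJ n j ζ)

/-- Set of exponents η such that for all sufficiently large X the simultaneous approximation
    system has at least j linearly independent integer vector solutions. -/
def lamhSetJ (n j : ℕ) (ζ : ℝ) : Set ℝ :=
  {η | ∃ X₀ : ℝ, ∀ X : ℝ, X₀ ≤ X → ∃ v : Fin j → (Fin (n + 1) → ℤ),
    LinearIndependent ℤ v ∧ ∀ i : Fin j,
      ((|v i 0| : ℤ) : ℝ) ≤ X ∧
      ∀ t : Fin n, |ζ ^ ((t : ℕ) + 1) * ((v i 0 : ℤ) : ℝ) - ((v i t.succ : ℤ) : ℝ)| ≤ X ^ (-η)}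

/-- The uniform exponent λ̂_{n,j}(ζ). -/
noncomputable def lamhExpJ (n j : ℕ) (ζ : ℝ) : ℝ := sSup (lamhSetJ n j ζ)

/-- An extremal number: a real transcendental number with ŵ₂(ζ) = (3+√5)/2. -/
def IsExtremal (ζ : ℝ) : Prop :=
  Transcendental ℚ ζ ∧ whExp 2 ζ = (3 + Real.sqrt 5) / 2


open MeasureTheory in
/-- Minkowski's theorem on linear forms. -/
theorem exists_int_vec_abs_mulVec_lt {ι : Type*} [Fintype ι] [DecidableEq ι]
    (A : Matrix ι ι ℝ) (hA : A.det ≠ 0) (c : ι → ℝ) (hc : ∀ i, 0 < c i)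
    (h : |A.det| < ∏ i, c i) :
    ∃ x : ι → ℤ, x ≠ 0 ∧ ∀ i, |(A.mulVec fun k => (x k : ℝ)) i| < c i := by
  classical
  set L : (ι → ℝ) →ₗ[ℝ] (ι → ℝ) := Matrix.toLin' A
  set S : Set (ι → ℝ) := L ⁻¹' (Set.pi Set.univ fun i => Set.Ioo (-c i) (c i)) with hS
  have hdet : LinearMap.det L ≠ 0 := by rwa [LinearMap.det_toLin']
  have hvol : volume S = ENNReal.ofReal |A.det|⁻¹ * ENNReal.ofReal (∏ i, (2 * c i)) := by
    rw [hS, Measure.addHaar_preimage_linearMap _ hdet, Real.volume_pi_Ioo, LinearMap.det_toLin',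
      ENNReal.ofReal_prod_of_nonneg (fun i _ => by have := hc i; positivity), abs_inv]
    congr 2
    ext i
    congr 1
    ring
  have hfund := ZSpan.isAddFundamentalDomain' (Pi.basisFun ℝ ι) volume
  have hlt : volume (ZSpan.fundamentalDomain (Pi.basisFun ℝ ι)) *
      2 ^ Module.finrank ℝ (ι → ℝ) < volume S := by
    rw [ZSpan.fundamentalDomain_pi_basisFun, hvol, Real.volume_pi_Ico,
      Module.finrank_fintype_fun_eq_card,
      ← ENNReal.ofReal_mul (by positivity), Finset.prod_mul_distrib]
    simp only [sub_zero, ENNReal.ofReal_one, Finset.prod_const_one, one_mul, Finset.prod_const,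
      Finset.card_univ]
    rw [show (2 : ENNReal) = ENNReal.ofReal 2 by simp, ← ENNReal.ofReal_pow (by norm_num)]
    have hp : 0 < |A.det| := abs_pos.2 hA
    apply (ENNReal.ofReal_lt_ofReal_iff (by have := hp.trans h; positivity)).2
    rw [inv_mul_eq_div, lt_div_iff₀ hp]
    gcongr
  have hsymm : ∀ x ∈ S, -x ∈ S := by
    intro x hx
    simp only [hS, Set.mem_preimage, Set.mem_pi, Set.mem_univ, true_imp_iff, map_neg, Pi.neg_apply,
      Set.mem_Ioo] at hx ⊢
    intro i
    have := hx i
    constructor <;> linarith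
  have hconv : Convex ℝ S :=
    (convex_pi fun i _ => convex_Ioo _ _).linear_preimage L
  have : Countable (Submodule.span ℤ (Set.range (Pi.basisFun ℝ ι))).toAddSubgroup :=
    inferInstanceAs (Countable (Submodule.span ℤ (Set.range (Pi.basisFun ℝ ι))))
  obtain ⟨x, hx0, hxS⟩ := exists_ne_zero_mem_lattice_of_measure_mul_two_pow_lt_measure
    hfund hsymm hconv hlt
  have hmem := x.2
  rw [Submodule.mem_toAddSubgroup, (Pi.basisFun ℝ ι).mem_span_iff_repr_mem ℤ] at hmem
  choose y hy using hmem
  have hy' : (fun k => (y k : ℝ)) = (x : ι → ℝ) := by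
    ext k
    simpa using hy k
  refine ⟨y, ?_, fun i => ?_⟩
  · rintro rfl
    apply hx0
    ext k
    simpa using (congrFun hy' k).symm
  · rw [hy', abs_lt]
    simpa [hS, L] using hxS i (Set.mem_univ i)

theorem det_updateRow_one {ι : Type*} [Fintype ι] [DecidableEq ι] (i : ι) (r : ι → ℝ) :
    ((1 : Matrix ι ι ℝ).updateRow i r).det = r i := by
  rw [← Matrix.cramer_transpose_apply]; simp

theorem det_updateCol_one {ι : Type*} [Fintype ι] [DecidableEq ι] (i : ι) (r : ι → ℝ) :
    ((1 : Matrix ι ι ℝ).updateCol i r).det = r i := by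
  rw [← Matrix.cramer_apply]; simp

theorem updateRow_one_mulVec {ι : Type*} [Fintype ι] [DecidableEq ι] (i : ι) (r x : ι → ℝ) :
    ((1 : Matrix ι ι ℝ).updateRow i r).mulVec x = Function.update x i (∑ k, r k * x k) := by
  ext k
  rcases eq_or_ne k i with rfl | h
  · simp [Matrix.mulVec, dotProduct]
  · simp [Matrix.mulVec, dotProduct, h, Matrix.one_apply]

theorem updateCol_one_mulVec_zero {n : ℕ} (r x : Fin (n + 1) → ℝ) :
    ((1 : Matrix (Fin (n + 1)) (Fin (n + 1)) ℝ).updateCol 0 r).mulVec x =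
      Fin.cons (r 0 * x 0) fun k : Fin n => r k.succ * x 0 + x k.succ := by
  ext k
  refine Fin.cases ?_ (fun k => ?_) k
  · simp [Matrix.mulVec, dotProduct, Fin.sum_univ_succ, Matrix.updateCol_apply, Matrix.one_apply,
      (Fin.succ_ne_zero _).symm]
  · simp [Matrix.mulVec, dotProduct, Fin.sum_univ_succ, Matrix.updateCol_apply, Matrix.one_apply]

theorem polyH_le {P : ℤ[X]} {B : ℝ} (hB : 0 ≤ B) (h : ∀ i, |(P.coeff i : ℝ)| ≤ B) :
    polyH P ≤ B := by
  unfold polyH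
  refine le_trans (Nat.cast_le.2 (Finset.sup_le fun i _ => ?_)) (Nat.floor_le hB)
  apply Nat.le_floor
  rw [Nat.cast_natAbs, Int.cast_abs]
  exact h i

theorem abs_coeff_le_polyH (P : ℤ[X]) (i : ℕ) : |(P.coeff i : ℝ)| ≤ polyH P := by
  unfold polyH
  rw [← Int.cast_abs, ← Nat.cast_natAbs, Nat.cast_le]
  by_cases hi : P.coeff i = 0
  · simp [hi]
  · exact Finset.le_sup (f := fun i => (P.coeff i).natAbs) (mem_support_iff.2 hi)

theorem pev_eq_sum (ζ : ℝ) {n : ℕ} {P : ℤ[X]} (hP : P.natDegree ≤ n) :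
    pev ζ P = P.coeff 0 + ∑ i : Fin n, (P.coeff ((i : ℕ) + 1) : ℝ) * ζ ^ ((i : ℕ) + 1) := by
  unfold pev
  rw [aeval_eq_sum_range' (Nat.lt_succ_of_le hP), ← Fin.sum_univ_eq_sum_range
    (fun i => P.coeff i • ζ ^ i), Fin.sum_univ_succ]
  simp

theorem exists_poly_of_coeffs {ζ : ℝ} (hζ : Transcendental ℚ ζ) {n : ℕ} {a : Fin (n + 1) → ℤ}
    (ha : a ≠ 0) {B : ℝ} (hB : ∀ i, |(a i : ℝ)| ≤ B) :
    ∃ P : ℤ[X], P.natDegree ≤ n ∧ polyH P ≤ B ∧ 0 < |pev ζ P| ∧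
      pev ζ P = a 0 + ∑ i : Fin n, (a i.succ : ℝ) * ζ ^ ((i : ℕ) + 1) := by
  have hB0 : 0 ≤ B := (abs_nonneg _).trans (hB 0)
  have hdeg : (ofFn (n + 1) a).natDegree ≤ n :=
    Nat.le_of_lt_succ (ofFn_natDegree_lt (by omega) a)
  refine ⟨ofFn (n + 1) a, hdeg, polyH_le hB0 fun i => ?_, ?_, ?_⟩
  · rcases lt_or_ge i (n + 1) with h | h
    · rw [ofFn_coeff_eq_val_of_lt a h]
      exact hB _
    · rw [ofFn_coeff_eq_zero_of_ge a h]
      simpa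
  · refine abs_pos.2 fun h => ha ?_
    have hζ' : Transcendental ℤ ζ := fun h => hζ (h.extendScalars (R := ℤ) (S := ℚ) Int.cast_injective)
    have h0 := (transcendental_iff.1 hζ') _ h
    exact injective_ofFn (n + 1) (h0.trans (map_zero (ofFn (n + 1))).symm)
  · rw [pev_eq_sum ζ hdeg, ofFn_coeff_eq_val_of_lt a (by omega)]
    congr 1
    refine Finset.sum_congr rfl fun i _ => ?_
    rw [ofFn_coeff_eq_val_of_lt a (by omega)]
    rfl

theorem exists_forall_mul_rpow_lt_rpow (C : ℝ) {a b : ℝ} (hab : a < b) :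
    ∃ X₀ : ℝ, 1 ≤ X₀ ∧ ∀ X, X₀ ≤ X → C * X ^ a < X ^ b := by
  have h := (tendsto_rpow_atTop (sub_pos.2 hab)).eventually_gt_atTop C
  obtain ⟨X₁, hX₁⟩ := Filter.eventually_atTop.1 h
  refine ⟨max X₁ 1, le_max_right _ _, fun X hX => ?_⟩
  have hX0 : 0 < X := by linarith [le_max_right X₁ 1]
  calc C * X ^ a < X ^ (b - a) * X ^ a :=
        mul_lt_mul_of_pos_right (hX₁ X ((le_max_left _ _).trans hX)) (Real.rpow_pos_of_pos hX0 a)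
    _ = X ^ b := by rw [← Real.rpow_add hX0, sub_add_cancel]

/-- Dirichlet's theorem on simultaneous approximation. -/
theorem mem_lamhSet_of_lt {n : ℕ} (ζ : ℝ) {τ : ℝ} (h : n * τ < 1) : τ ∈ lamhSet n ζ := by
  refine ⟨2, fun X hX => ?_⟩
  have hX0 : 0 < X := by linarith
  obtain ⟨x, hx, hxb⟩ := exists_int_vec_abs_mulVec_lt
    ((1 : Matrix (Fin (n + 1)) (Fin (n + 1)) ℝ).updateCol 0 fun k => if k = 0 then 1 else -ζ ^ (k : ℕ))
    (by simp [det_updateCol_one]) (Fin.cons X fun _ => X ^ (-τ))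
    (fun i => by refine Fin.cases ?_ (fun k => ?_) i <;> simp <;> positivity) (by
      rw [det_updateCol_one, Fin.prod_univ_succ]
      simp only [if_true, abs_one, Fin.cons_zero, Fin.cons_succ, Finset.prod_const,
        Finset.card_univ, Fintype.card_fin]
      rw [← Real.rpow_natCast, ← Real.rpow_mul hX0.le]
      nth_rw 1 [← Real.rpow_one X]
      rw [← Real.rpow_add hX0]
      exact Real.one_lt_rpow (by linarith) (by linarith))
  rw [updateCol_one_mulVec_zero] at hxb
  refine ⟨x 0, fun k => x k.succ, ?_, ?_, fun i => ?_⟩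
  · by_contra! hcon
    refine hx (funext fun k => Fin.cases hcon.1 (fun k => congrFun hcon.2 k) k)
  · simpa using (hxb 0).le
  · have := (hxb i.succ).le
    rw [abs_sub_comm]
    simp only [Fin.cons_succ, Fin.succ_ne_zero, if_false, Fin.val_succ] at this
    rwa [neg_mul, neg_add_eq_sub] at this

/-- Dirichlet's theorem on small values of integer polynomials. -/
theorem mem_whSet_of_lt {n : ℕ} {ζ : ℝ} (hζ : Transcendental ℚ ζ) {η : ℝ} (hη : 0 < η)
    (h : η < n) : η ∈ whSet n ζ := by
  set Z : ℝ := ∑ i : Fin n, |ζ| ^ ((i : ℕ) + 1)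
  have hZ : 0 ≤ Z := by positivity
  set c : ℝ := (2 + Z)⁻¹ with hc
  have hc0 : 0 < c := by positivity
  obtain ⟨X₀, hX₀, hlt⟩ := exists_forall_mul_rpow_lt_rpow ((c ^ n)⁻¹) (sub_pos.2 h)
  refine ⟨max X₀ (2 + Z), fun X hX => ?_⟩
  have hX1 : 1 ≤ X := hX₀.trans ((le_max_left _ _).trans hX)
  have hXZ : 1 ≤ c * X := by
    rw [hc, inv_mul_eq_div, one_le_div (by positivity)]
    exact (le_max_right _ _).trans hX
  have hX0 : 0 < X := by linarith
  have hprod : 1 < X ^ (-η) * (c * X) ^ n := by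
    have := hlt X ((le_max_left _ _).trans hX)
    rw [Real.rpow_zero, mul_one, inv_lt_iff_one_lt_mul₀ (by positivity)] at this
    calc 1 < c ^ n * X ^ (n - η) := by linarith
      _ = X ^ (-η) * (c * X) ^ n := by
        rw [sub_eq_add_neg, Real.rpow_add hX0, Real.rpow_natCast, mul_pow]; ring
  obtain ⟨a, ha, hab⟩ := exists_int_vec_abs_mulVec_lt
    ((1 : Matrix (Fin (n + 1)) (Fin (n + 1)) ℝ).updateRow 0 fun k => ζ ^ (k : ℕ))
    (by simp [det_updateRow_one]) (Fin.cons (X ^ (-η)) fun _ => c * X)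
    (fun i => by refine Fin.cases ?_ (fun k => ?_) i <;> simp <;> positivity) (by
      rw [det_updateRow_one, Fin.prod_univ_succ]
      simpa using hprod)
  rw [updateRow_one_mulVec] at hab
  have hev : |(a 0 : ℝ) + ∑ i : Fin n, (a i.succ : ℝ) * ζ ^ ((i : ℕ) + 1)| ≤ X ^ (-η) := by
    have := (hab 0).le
    simpa [Fin.sum_univ_succ, mul_comm] using this
  have hs : ∀ i : Fin n, |(a i.succ : ℝ)| ≤ c * X := fun i => by
    simpa using (hab i.succ).le
  have hX' : X ^ (-η) ≤ 1 := Real.rpow_le_one_of_one_le_of_nonpos hX1 (by linarith)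
  have hsum : |∑ i : Fin n, (a i.succ : ℝ) * ζ ^ ((i : ℕ) + 1)| ≤ c * X * Z := by
    refine (Finset.abs_sum_le_sum_abs _ _).trans ?_
    rw [Finset.mul_sum]
    refine Finset.sum_le_sum fun i _ => ?_
    rw [abs_mul, abs_pow]
    exact mul_le_mul_of_nonneg_right (hs i) (by positivity)
  have hcZ : c * X * (2 + Z) = X := by rw [hc]; field_simp
  obtain ⟨P, hP, hH, hpos, hPe⟩ := exists_poly_of_coeffs hζ ha (B := X) fun i => by
    refine Fin.cases ?_ (fun i => ?_) i
    · have := abs_sub_abs_le_abs_sub (a 0 : ℝ) (-∑ i : Fin n, (a i.succ : ℝ) * ζ ^ ((i : ℕ) + 1))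
      rw [sub_neg_eq_add, abs_neg] at this
      linarith
    · have : 0 ≤ c * X * Z := by positivity
      linarith [hs i]
  exact ⟨P, hP, hH, hpos, hPe ▸ hev⟩

theorem abs_le_of_sum_mul {n : ℕ} {a d : Fin n → ℝ} {j : Fin n} {E : ℝ} (hE : 0 ≤ E)
    (haj : a j ≠ 0) (ha : ∀ i, |a i| ≤ |a j|) (hd : ∀ i, i ≠ j → |d i| ≤ E) :
    |d j| ≤ |∑ i, a i * d i| / |a j| + n * E := by
  have hpos : 0 < |a j| := abs_pos.2 haj
  have hsum := Finset.add_sum_erase Finset.univ (fun i => a i * d i) (Finset.mem_univ j)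
  have herase : |∑ i ∈ Finset.univ.erase j, a i * d i| ≤ n * (|a j| * E) := by
    refine (Finset.abs_sum_le_sum_abs _ _).trans ?_
    refine (Finset.sum_le_card_nsmul _ _ (|a j| * E) fun i hi => ?_).trans ?_
    · rw [abs_mul]
      exact mul_le_mul (ha i) (hd i (Finset.ne_of_mem_erase hi)) (abs_nonneg _) hpos.le
    · rw [nsmul_eq_mul]
      refine mul_le_mul_of_nonneg_right ?_ (by positivity)
      exact_mod_cast (Finset.card_le_univ _).trans (Fintype.card_fin n).le
  have h1 : |a j| * |d j| ≤ |∑ i, a i * d i| + n * (|a j| * E) := by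
    rw [← abs_mul, ← hsum]
    have := abs_sub_abs_le_abs_sub (a j * d j) (-∑ i ∈ Finset.univ.erase j, a i * d i)
    rw [sub_neg_eq_add, abs_neg] at this
    linarith
  calc |d j| = |a j| * |d j| / |a j| := by field_simp
    _ ≤ (|∑ i, a i * d i| + n * (|a j| * E)) / |a j| := by gcongr
    _ = _ := by field_simp

theorem prod_update_const {n : ℕ} (j : Fin n) (H : ℝ) :
    ∏ i, Function.update (fun _ : Fin n => H) j 1 i = H ^ (n - 1) := by
  rw [Finset.prod_update_of_mem (Finset.mem_univ j), one_mul, Finset.prod_const,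
    ← Finset.erase_eq, Finset.card_erase_of_mem (Finset.mem_univ j)]
  simp

theorem Int.eq_zero_of_abs_cast_lt_one {z : ℤ} (h : |(z : ℝ)| < 1) : z = 0 := by
  rw [← Int.cast_abs] at h
  exact Int.abs_lt_one_iff.1 (by exact_mod_cast h)

/-- A linear form with a small value yields a good simultaneous approximation on its kernel. -/
theorem exists_simultaneous_of_linear_form {n : ℕ} (ζ : ℝ) (a₀ : ℤ) (a : Fin n → ℤ) (j : Fin n)
    (haj : a j ≠ 0) (ha : ∀ i, |(a i : ℝ)| ≤ |(a j : ℝ)|) {E : ℝ} (hE : 0 < E)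
    (hp : |(a₀ : ℝ) + ∑ i : Fin n, (a i : ℝ) * ζ ^ ((i : ℕ) + 1)| ≤ E ^ n) :
    ∃ x : ℤ, ∃ y : Fin n → ℤ, (x ≠ 0 ∨ y ≠ 0) ∧ |(x : ℝ)| ≤ 2 * |(a j : ℝ)| / E ^ (n - 1) ∧
      ∀ i : Fin n, |ζ ^ ((i : ℕ) + 1) * (x : ℝ) - (y i : ℝ)| ≤ (n + 2) * E := by
  set p : ℝ := a₀ + ∑ i : Fin n, (a i : ℝ) * ζ ^ ((i : ℕ) + 1) with hpdef
  have haj' : (a j : ℝ) ≠ 0 := by exact_mod_cast haj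
  have hA : 0 < |(a j : ℝ)| := abs_pos.2 haj'
  set Q : ℝ := 2 * |(a j : ℝ)| / E ^ (n - 1) with hQ
  have hQ0 : 0 < Q := by positivity
  set M : Matrix (Fin (n + 1)) (Fin (n + 1)) ℝ :=
    (1 : Matrix (Fin (n + 1)) (Fin (n + 1)) ℝ).updateRow j.succ (Fin.cons p fun i => (a i : ℝ)) *
    (1 : Matrix (Fin (n + 1)) (Fin (n + 1)) ℝ).updateCol 0
      (fun k => if k = 0 then 1 else -ζ ^ (k : ℕ)) with hM
  have hdet : M.det = a j := by
    rw [hM, Matrix.det_mul, det_updateRow_one, det_updateCol_one]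
    simp
  obtain ⟨x, hx, hxb⟩ := exists_int_vec_abs_mulVec_lt M (by rwa [hdet])
    (Fin.cons Q (Function.update (fun _ => E) j 1))
    (fun i => by
      refine Fin.cases ?_ (fun k => ?_) i
      · simpa
      · rcases eq_or_ne k j with rfl | h
        · simp
        · simpa [h]) (by
      rw [hdet, Fin.prod_univ_succ]
      simp only [Fin.cons_zero, Fin.cons_succ]
      rw [prod_update_const, hQ, div_mul_cancel₀ _ (by positivity)]
      linarith)
  rw [hM, ← Matrix.mulVec_mulVec, updateCol_one_mulVec_zero, updateRow_one_mulVec] at hxb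
  set d : Fin n → ℝ := fun i => -ζ ^ ((i : ℕ) + 1) * x 0 + x i.succ with hd
  have hx0 : |(x 0 : ℝ)| ≤ Q := by
    simpa [Function.update_of_ne (Fin.succ_ne_zero j).symm] using (hxb 0).le
  have hdi : ∀ i, i ≠ j → |d i| ≤ E := fun i hi => by
    have := (hxb i.succ).le
    simpa [Function.update_of_ne (fun h => hi (Fin.succ_injective _ h) : i.succ ≠ j.succ), hi,
      hd] using this
  have hker : (x 0 : ℝ) * p + ∑ i, (a i : ℝ) * d i = 0 := by
    have h1 := hxb j.succ
    rw [Function.update_self] at h1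
    simp only [Fin.sum_univ_succ, Fin.cons_zero, Fin.cons_succ, Function.update_self, if_true,
      one_mul, Fin.succ_ne_zero, if_false, Fin.val_succ] at h1
    have h2 : (x 0 : ℝ) * p + ∑ i, (a i : ℝ) * d i
        = ((a₀ * x 0 + ∑ i, a i * x i.succ : ℤ) : ℝ) := by
      push_cast
      simp only [hpdef, hd, mul_add, Finset.mul_sum, Finset.sum_add_distrib, add_assoc]
      rw [← add_assoc (∑ i : Fin n, _), ← Finset.sum_add_distrib]
      rw [Finset.sum_eq_zero fun i _ => by ring]
      ring
    rw [mul_comm p] at h1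
    change |(x 0 : ℝ) * p + ∑ i, (a i : ℝ) * d i| < 1 at h1
    rw [h2] at h1 ⊢
    exact_mod_cast Int.eq_zero_of_abs_cast_lt_one h1
  have hdj := abs_le_of_sum_mul hE.le haj' ha hdi
  have hall : ∀ i, |d i| ≤ (n + 2) * E := by
    intro i
    rcases eq_or_ne i j with rfl | hi
    · refine hdj.trans ?_
      rw [eq_neg_of_add_eq_zero_right hker, abs_neg, abs_mul, add_comm (n : ℝ), add_mul]
      gcongr
      rw [div_le_iff₀ hA]
      refine (mul_le_mul hx0 hp (abs_nonneg _) hQ0.le).trans (le_of_eq ?_)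
      have hn : n = n - 1 + 1 := by have := i.pos; omega
      rw [hQ]
      nth_rw 2 [hn]
      rw [pow_succ]
      field_simp
    · have := hdi i hi
      nlinarith [(Nat.cast_nonneg n : (0 : ℝ) ≤ n)]
  refine ⟨x 0, fun k => x k.succ, ?_, hx0, fun i => ?_⟩
  · by_contra! hcon
    refine hx (funext fun k => Fin.cases hcon.1 (fun k => congrFun hcon.2 k) k)
  · have := hall i
    simp only [hd] at this
    rwa [neg_mul, neg_add_eq_sub, abs_sub_comm] at this

/-- Khintchine-type transference between the two uniform exponents. -/
theorem exists_mem_lamhSet_of_mem_whSet {n : ℕ} (hn : 1 ≤ n) {ζ η : ℝ} (hη : n < η)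
    (h : η ∈ whSet n ζ) : ∃ τ : ℝ, 1 < n * τ ∧ τ ∈ lamhSet n ζ := by
  obtain ⟨X₁, hX₁⟩ := h
  have hn' : (1 : ℝ) ≤ n := by exact_mod_cast hn
  have hη0 : 0 < η := by linarith
  have hden : 0 < n + η * (n - 1) := by nlinarith
  obtain ⟨α, hα1, hα2⟩ : ∃ α, 1 / η < α ∧ α < n / (n + η * (n - 1)) := by
    apply exists_between
    rw [div_lt_div_iff₀ hη0 hden]
    nlinarith
  rw [div_lt_iff₀ hη0] at hα1
  rw [lt_div_iff₀ hden] at hα2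
  have hα0 : 0 < α := by
    by_contra! hcon
    nlinarith
  obtain ⟨τ', hτ1, hτ2⟩ : ∃ τ' : ℝ, 1 / n < τ' ∧ τ' < α * η / n :=
    exists_between (div_lt_div_of_pos_right hα1 (by positivity))
  obtain ⟨τ, hτ3, hτ4⟩ := exists_between hτ1
  rw [lt_div_iff₀ (by positivity)] at hτ2
  rw [div_lt_iff₀ (by positivity)] at hτ3
  have hexp : α + τ' * (n - 1) < 1 := by
    have : n * (α + τ' * (n - 1)) < n * 1 := by nlinarith
    exact lt_of_mul_lt_mul_left this (by positivity)
  obtain ⟨Y₁, hY₁, hY₁'⟩ := exists_forall_mul_rpow_lt_rpow 2 hexp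
  obtain ⟨Y₂, hY₂, hY₂'⟩ := exists_forall_mul_rpow_lt_rpow (n + 2) (neg_lt_neg hτ4)
  obtain ⟨Y₃, hY₃, hY₃'⟩ := exists_forall_mul_rpow_lt_rpow (max X₁ 1) hα0
  refine ⟨τ, by linarith, max (max Y₁ Y₂) Y₃, fun Y hY => ?_⟩
  have hYY₁ : Y₁ ≤ Y := (le_max_left _ _).trans ((le_max_left _ _).trans hY)
  have hYY₂ : Y₂ ≤ Y := (le_max_right _ _).trans ((le_max_left _ _).trans hY)
  have hYY₃ : Y₃ ≤ Y := (le_max_right _ _).trans hY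
  have hY1 : 1 ≤ Y := hY₁.trans hYY₁
  have hY0 : 0 < Y := by linarith
  have hX := hY₃' Y hYY₃
  rw [Real.rpow_zero, mul_one] at hX
  obtain ⟨P, hdeg, hH, hpos, hle⟩ := hX₁ (Y ^ α) ((le_max_left _ _).trans hX.le)
  have hXη : (Y ^ α) ^ (-η) < 1 :=
    Real.rpow_lt_one_of_one_lt_of_neg ((le_max_right _ _).trans_lt hX) (by linarith)
  have : Nonempty (Fin n) := ⟨⟨0, hn⟩⟩
  obtain ⟨j, hj⟩ := Finite.exists_max fun i : Fin n => |(P.coeff ((i : ℕ) + 1) : ℝ)|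
  have hPe := pev_eq_sum ζ hdeg
  have hPj : P.coeff ((j : ℕ) + 1) ≠ 0 := by
    intro h0
    have hz : ∀ i : Fin n, (P.coeff ((i : ℕ) + 1) : ℝ) = 0 := fun i => by
      have := hj i
      simpa [h0] using this
    simp only [hz, zero_mul, Finset.sum_const_zero, add_zero] at hPe
    have := Int.eq_zero_of_abs_cast_lt_one (hPe ▸ hle.trans_lt hXη)
    rw [hPe, this] at hpos
    simp at hpos
  obtain ⟨x, y, hxy, hx, he⟩ := exists_simultaneous_of_linear_form ζ (P.coeff 0)
    (fun i : Fin n => P.coeff ((i : ℕ) + 1)) j hPj hj (Real.rpow_pos_of_pos hY0 (-τ')) (by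
      rw [← hPe]
      refine hle.trans ?_
      rw [← Real.rpow_natCast, ← Real.rpow_mul hY0.le, ← Real.rpow_mul hY0.le]
      exact Real.rpow_le_rpow_of_exponent_le hY1 (by linarith))
  refine ⟨x, y, hxy, ?_, fun i => (he i).trans (hY₂' Y hYY₂).le⟩
  rw [Int.cast_abs]
  have hlast := (hY₁' Y hYY₁).le
  rw [Real.rpow_one] at hlast
  refine hx.trans (le_trans (le_of_eq_of_le
    (b := 2 * |(P.coeff ((j : ℕ) + 1) : ℝ)| * Y ^ (τ' * (n - 1))) ?_ ?_) hlast)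
  · rw [← Real.rpow_natCast, ← Real.rpow_mul hY0.le, Nat.cast_sub hn, Nat.cast_one, neg_mul,
      Real.rpow_neg hY0.le, div_inv_eq_mul]
  · rw [Real.rpow_add hY0, ← mul_assoc]
    gcongr
    exact (abs_coeff_le_polyH P _).trans hH

/-- A small integer vector orthogonal to two given integer vectors `(u₀, u)` and `(v₀, v)`. -/
theorem exists_orthogonal_int_vec {n : ℕ} {u₀ v₀ : ℤ} (hu₀ : u₀ ≠ 0) (u v : Fin n → ℤ) (j : Fin n)
    (hj : u₀ * v j - v₀ * u j ≠ 0)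
    (hmax : ∀ i, |((u₀ * v i - v₀ * u i : ℤ) : ℝ)| ≤ |((u₀ * v j - v₀ * u j : ℤ) : ℝ)|)
    {H : ℝ} (hH : 0 < H) (hlt : |((u₀ * v j - v₀ * u j : ℤ) : ℝ)| < H ^ (n - 1)) :
    ∃ a : Fin (n + 1) → ℤ, a ≠ 0 ∧ v₀ * a 0 + ∑ i, v i * a i.succ = 0 ∧
      ∀ i : Fin n, |(a i.succ : ℝ)| ≤ n * H := by
  have hu₀' : (u₀ : ℝ) ≠ 0 := by exact_mod_cast hu₀
  have hj' : ((u₀ * v j - v₀ * u j : ℤ) : ℝ) ≠ 0 := by exact_mod_cast hj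
  set M : Matrix (Fin (n + 1)) (Fin (n + 1)) ℝ :=
    (1 : Matrix (Fin (n + 1)) (Fin (n + 1)) ℝ).updateRow j.succ
      (Fin.cons (v₀ / u₀ : ℝ) fun i => (v i - v₀ / u₀ * u i : ℝ)) *
    (1 : Matrix (Fin (n + 1)) (Fin (n + 1)) ℝ).updateRow 0
      (Fin.cons (u₀ : ℝ) fun i => (u i : ℝ)) with hM
  have hdet : M.det = ((u₀ * v j - v₀ * u j : ℤ) : ℝ) := by
    rw [hM, Matrix.det_mul, det_updateRow_one, det_updateRow_one]
    simp only [Fin.cons_zero, Fin.cons_succ]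
    push_cast
    field_simp
  obtain ⟨a, ha, hab⟩ := exists_int_vec_abs_mulVec_lt M (by rwa [hdet])
    (Fin.cons 1 (Function.update (fun _ => H) j 1))
    (fun i => by
      refine Fin.cases ?_ (fun k => ?_) i
      · simp
      · rcases eq_or_ne k j with rfl | h
        · simp
        · simpa [h]) (by
      rw [hdet, Fin.prod_univ_succ]
      simp only [Fin.cons_zero, Fin.cons_succ]
      rwa [prod_update_const, one_mul])
  rw [hM, ← Matrix.mulVec_mulVec, updateRow_one_mulVec, updateRow_one_mulVec] at hab
  have hu : u₀ * a 0 + ∑ i, u i * a i.succ = 0 := by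
    have h1 := hab 0
    rw [Function.update_of_ne (Fin.succ_ne_zero j).symm, Function.update_self] at h1
    apply Int.eq_zero_of_abs_cast_lt_one
    push_cast
    simpa [Fin.sum_univ_succ] using h1
  have hv : v₀ * a 0 + ∑ i, v i * a i.succ = 0 := by
    have h1 := hab j.succ
    rw [Function.update_self] at h1
    apply Int.eq_zero_of_abs_cast_lt_one
    have hu' : (u₀ : ℝ) * a 0 + ∑ i, (u i : ℝ) * a i.succ = 0 := by exact_mod_cast hu
    simp only [Fin.sum_univ_succ, Fin.cons_zero, Fin.cons_succ, Function.update_self,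
      Function.update_of_ne (Fin.succ_ne_zero _), hu', mul_zero, zero_add, sub_mul,
      Finset.sum_sub_distrib, mul_assoc, ← Finset.mul_sum] at h1
    rw [eq_neg_of_add_eq_zero_right hu'] at h1
    push_cast
    convert h1 using 2
    field_simp
    ring
  have hai : ∀ i, i ≠ j → |(a i.succ : ℝ)| ≤ H := fun i hi => by
    have h1 := (hab i.succ).le
    rw [Function.update_of_ne (fun h => hi (Fin.succ_injective _ h)),
      Function.update_of_ne (Fin.succ_ne_zero _)] at h1
    simpa [hi] using h1
  have hD : ∑ i, ((u₀ * v i - v₀ * u i : ℤ) : ℝ) * (a i.succ : ℝ) = 0 := by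
    have : ∑ i, (u₀ * v i - v₀ * u i) * a i.succ = 0 := by
      simp only [sub_mul, Finset.sum_sub_distrib, mul_assoc, ← Finset.mul_sum]
      linear_combination u₀ * hv - v₀ * hu
    exact_mod_cast this
  have hn : (1 : ℝ) ≤ n := by exact_mod_cast j.pos
  have haj := abs_le_of_sum_mul hH.le hj' hmax hai
  refine ⟨a, ha, hv, fun i => ?_⟩
  rcases eq_or_ne i j with rfl | hi
  · rw [hD] at haj
    simpa using haj
  · exact (hai i hi).trans (by nlinarith)

theorem exists_nat_approx {n : ℕ} {ζ ε X : ℝ} (hε : ε < 1) {x : ℤ} {y : Fin n → ℤ}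
    (hxy : x ≠ 0 ∨ y ≠ 0) (hx : ((|x| : ℤ) : ℝ) ≤ X)
    (h : ∀ i : Fin n, |ζ ^ ((i : ℕ) + 1) * (x : ℝ) - (y i : ℝ)| ≤ ε) :
    ∃ m : ℕ, 0 < m ∧ (m : ℝ) ≤ X ∧
      ∃ z : Fin n → ℤ, ∀ i : Fin n, |ζ ^ ((i : ℕ) + 1) * (m : ℝ) - (z i : ℝ)| ≤ ε := by
  have hx0 : x ≠ 0 := by
    rintro rfl
    refine hxy.elim (fun h => h rfl) fun hy => hy (funext fun i => ?_)
    apply Int.eq_zero_of_abs_cast_lt_one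
    simpa using (h i).trans_lt hε
  refine ⟨x.natAbs, Int.natAbs_pos.2 hx0, by rwa [Nat.cast_natAbs], ?_⟩
  rcases le_total 0 x with hs | hs
  · refine ⟨y, fun i => ?_⟩
    rw [Nat.cast_natAbs, abs_of_nonneg hs]
    exact h i
  · refine ⟨-y, fun i => ?_⟩
    rw [Nat.cast_natAbs, abs_of_nonpos hs, Int.cast_neg, Pi.neg_apply, Int.cast_neg, mul_neg,
      neg_sub_neg, abs_sub_comm]
    exact h i

theorem exists_pos_forall_lt_abs_sub {ζ : ℝ} (hζ : Irrational ζ) (N : ℕ) :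
    ∃ ε : ℝ, 0 < ε ∧ ∀ m : ℕ, 0 < m → m ≤ N → ∀ z : ℤ, ε < |ζ * m - z| := by
  induction N with
  | zero => exact ⟨1, one_pos, fun m hm hm' => by omega⟩
  | succ N ih =>
    obtain ⟨ε, hε, h⟩ := ih
    set δ : ℝ := |ζ * (N + 1 : ℕ) - round (ζ * (N + 1 : ℕ))| with hδ
    have hδ0 : 0 < δ := by
      refine abs_pos.2 (sub_ne_zero.2 fun hcon => ?_)
      exact (hζ.mul_natCast (Nat.succ_ne_zero N)).ne_int _ hcon
    refine ⟨min ε (δ / 2), by positivity, fun m hm hmN z => ?_⟩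
    rcases Nat.lt_or_ge m (N + 1) with hlt | hge
    · exact (min_le_left _ _).trans_lt (h m hm (by omega) z)
    · obtain rfl : m = N + 1 := by omega
      have := round_le (ζ * (N + 1 : ℕ)) z
      exact (min_le_right _ _).trans_lt (by linarith)

/-- A minimal point together with an independent companion, and the resulting minors. -/
theorem exists_independent_approx_pair {n : ℕ} (hn : 1 ≤ n) {ζ : ℝ} (hζ : Irrational ζ)
    {τ l : ℝ} (hτ : 0 < τ) (hτl : τ ≤ l) (hτs : τ ∈ lamhSet n ζ) (hls : l ∈ lamSet n ζ) (N : ℝ) :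
    ∃ V u₀ : ℕ, ∃ u v : Fin n → ℤ, N ≤ V ∧ 0 < V ∧ 0 < u₀ ∧
      (∀ i : Fin n, |ζ ^ ((i : ℕ) + 1) * (V : ℝ) - (v i : ℝ)| ≤ (V : ℝ) ^ (-l)) ∧
      ∃ j, (u₀ : ℤ) * v j - V * u j ≠ 0 ∧
        (∀ i, |((u₀ * v i - V * u i : ℤ) : ℝ)| ≤ |((u₀ * v j - V * u j : ℤ) : ℝ)|) ∧
        |((u₀ * v j - V * u j : ℤ) : ℝ)| ≤ (1 + 2 ^ τ) * (V : ℝ) ^ (1 - τ) := by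
  classical
  have hl : 0 < l := hτ.trans_le hτl
  obtain ⟨X₁, hX₁⟩ := hτs
  obtain ⟨N', hN'⟩ := exists_nat_gt (max N (max (2 * X₁) 2))
  obtain ⟨ε₀, hε₀, hirr⟩ := exists_pos_forall_lt_abs_sub hζ N'
  obtain ⟨X₂, hX₂⟩ := Filter.eventually_atTop.1
    ((tendsto_rpow_neg_atTop hl).eventually_lt_const (lt_min hε₀ one_pos))
  obtain ⟨X, hX, x, y, hxy, hx, he⟩ := hls (max X₂ 1)
  have hX0 : 0 < X := one_pos.trans_le ((le_max_right _ _).trans hX)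
  have hε := hX₂ X ((le_max_left _ _).trans hX)
  set ε : ℝ := X ^ (-l)
  have hex : ∃ m : ℕ, 0 < m ∧
      ∃ z : Fin n → ℤ, ∀ i : Fin n, |ζ ^ ((i : ℕ) + 1) * (m : ℝ) - (z i : ℝ)| ≤ ε := by
    obtain ⟨m, hm, -, hz⟩ := exists_nat_approx (hε.trans_le (min_le_right _ _)) hxy hx he
    exact ⟨m, hm, hz⟩
  obtain ⟨hV0, v, hv⟩ := Nat.find_spec hex
  have hVX : (Nat.find hex : ℝ) ≤ X := by
    obtain ⟨m, hm, hmX, hz⟩ := exists_nat_approx (hε.trans_le (min_le_right _ _)) hxy hx he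
    exact (Nat.cast_le.2 (Nat.find_min' hex ⟨hm, hz⟩)).trans hmX
  have hmin : ∀ m : ℕ, 0 < m → m < Nat.find hex → ∀ z : Fin n → ℤ,
      ∃ i : Fin n, ε < |ζ ^ ((i : ℕ) + 1) * (m : ℝ) - (z i : ℝ)| := by
    intro m hm hlt z
    by_contra! hcon
    exact Nat.find_min hex hlt ⟨hm, z, hcon⟩
  set V := Nat.find hex
  have hVN : (N' : ℝ) < V := by
    rw [Nat.cast_lt]
    by_contra! hcon
    have h1 := hirr V hV0 hcon (v ⟨0, hn⟩)
    have h2 := hv ⟨0, hn⟩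
    simp only [zero_add, pow_one] at h2
    linarith [min_le_left ε₀ 1]
  have hVmax : max N (max (2 * X₁) 2) < V := hN'.trans hVN
  have hVN : N < V := (le_max_left _ _).trans_lt hVmax
  have hVX₁ : 2 * X₁ < V := (le_max_left _ _).trans_lt ((le_max_right _ _).trans_lt hVmax)
  have hV2 : (2 : ℝ) < V := (le_max_right _ _).trans_lt ((le_max_right _ _).trans_lt hVmax)
  have hVpos : (0 : ℝ) < V := by linarith
  have hvV : ∀ i : Fin n, |ζ ^ ((i : ℕ) + 1) * (V : ℝ) - (v i : ℝ)| ≤ (V : ℝ) ^ (-l) := fun i =>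
    (hv i).trans (Real.rpow_le_rpow_of_nonpos hVpos hVX (by linarith))
  obtain ⟨x', y', hxy', hx', he'⟩ := hX₁ (V / 2) (by linarith)
  obtain ⟨u₀, hu₀, hu₀V, u, hu⟩ := exists_nat_approx
    (Real.rpow_lt_one_of_one_lt_of_neg (by linarith) (by linarith)) hxy' hx' he'
  have hu₀' : (0 : ℝ) < u₀ := by exact_mod_cast hu₀
  have : Nonempty (Fin n) := ⟨⟨0, hn⟩⟩
  obtain ⟨j, hj⟩ := Finite.exists_max fun i : Fin n => |((u₀ * v i - V * u i : ℤ) : ℝ)|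
  refine ⟨V, u₀, u, v, hVN.le, hV0, hu₀, hvV, j, fun h0 => ?_, hj, ?_⟩
  · obtain ⟨i, hi⟩ := hmin u₀ hu₀ (by
      have : (u₀ : ℝ) < V := by linarith
      exact_mod_cast this) u
    have hz : (u₀ : ℤ) * v i - V * u i = 0 := by
      have := hj i
      rw [h0, Int.cast_zero, abs_zero] at this
      exact_mod_cast abs_nonpos_iff.1 this
    have hz' : (u₀ : ℝ) * v i - V * u i = 0 := by exact_mod_cast hz
    have heq : V * (ζ ^ ((i : ℕ) + 1) * (u₀ : ℝ) - u i) =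
        u₀ * (ζ ^ ((i : ℕ) + 1) * (V : ℝ) - v i) := by linear_combination hz'
    have habs := congrArg abs heq
    rw [abs_mul, abs_mul, abs_of_pos hVpos, abs_of_pos hu₀'] at habs
    have h3 := hv i
    nlinarith [abs_nonneg (ζ ^ ((i : ℕ) + 1) * (V : ℝ) - v i),
      abs_nonneg (ζ ^ ((i : ℕ) + 1) * (u₀ : ℝ) - u i)]
  · have heq : ((u₀ * v j - V * u j : ℤ) : ℝ) = V * (ζ ^ ((j : ℕ) + 1) * (u₀ : ℝ) - u j) -
        u₀ * (ζ ^ ((j : ℕ) + 1) * (V : ℝ) - v j) := by push_cast; ring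
    have h1 : |(V : ℝ) * (ζ ^ ((j : ℕ) + 1) * (u₀ : ℝ) - u j)| ≤ 2 ^ τ * (V : ℝ) ^ (1 - τ) := by
      rw [abs_mul, abs_of_pos hVpos]
      refine (mul_le_mul_of_nonneg_left (hu j) hVpos.le).trans (le_of_eq ?_)
      rw [Real.div_rpow hVpos.le two_pos.le, Real.rpow_neg two_pos.le, div_inv_eq_mul,
        sub_eq_add_neg, Real.rpow_add hVpos, Real.rpow_one]
      ring
    have h2 : |(u₀ : ℝ) * (ζ ^ ((j : ℕ) + 1) * (V : ℝ) - v j)| ≤ (V : ℝ) ^ (1 - τ) := by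
      rw [abs_mul, abs_of_pos hu₀', sub_eq_add_neg 1 τ, Real.rpow_add hVpos, Real.rpow_one]
      refine mul_le_mul (by linarith) ((hvV j).trans ?_) (abs_nonneg _) hVpos.le
      exact Real.rpow_le_rpow_of_exponent_le (by linarith) (by linarith)
    rw [heq]
    refine (abs_sub _ _).trans ?_
    linarith

/-- Lower bound for `w_n` in terms of `λ_n` and the uniform exponent. -/
theorem mem_wSet_of_mem_lamhSet_of_mem_lamSet {n : ℕ} (hn : 1 ≤ n) {ζ : ℝ}
    (hζ : Transcendental ℚ ζ) {τ l κ : ℝ} (hτ1 : 1 < n * τ) (hτl : τ ≤ l)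
    (hτs : τ ∈ lamhSet n ζ) (hls : l ∈ lamSet n ζ) (hκ0 : 0 < κ) (hκ : 1 - τ < κ * (n - 1 : ℕ)) :
    (1 + l) / κ - 1 ∈ wSet n ζ := by
  have hn' : (1 : ℝ) ≤ n := by exact_mod_cast hn
  have hτ : 0 < τ := by
    by_contra! h
    nlinarith
  have hirr : Irrational ζ := hζ.irrational
  obtain ⟨κ', hκ₁, hκ₂⟩ : ∃ κ', κ' < κ ∧ 1 - τ < κ' * (n - 1 : ℕ) := by
    rcases (Nat.cast_nonneg (n - 1) : (0 : ℝ) ≤ (n - 1 : ℕ)).eq_or_lt with h | h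
    · exact ⟨κ - 1, by linarith, by rw [← h] at hκ ⊢; linarith⟩
    · obtain ⟨κ', h1, h2⟩ := exists_between ((div_lt_iff₀ h).2 hκ)
      exact ⟨κ', h2, (div_lt_iff₀ h).1 h1⟩
  set Z : ℝ := ∑ i : Fin n, |ζ| ^ ((i : ℕ) + 1)
  have hZ : 0 ≤ Z := by positivity
  obtain ⟨V₁, hV₁, hV₁'⟩ := exists_forall_mul_rpow_lt_rpow (1 + 2 ^ τ) hκ₂
  obtain ⟨V₂, hV₂, hV₂'⟩ := exists_forall_mul_rpow_lt_rpow (n * n + n * Z + n) hκ₁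
  intro X₀
  obtain ⟨V₄, hV₄, hV₄'⟩ := exists_forall_mul_rpow_lt_rpow X₀ hκ0
  obtain ⟨V, u₀, u, v, hVN, hV0, hu₀, hv, j, hj, hmax, hD⟩ :=
    exists_independent_approx_pair hn hirr hτ hτl hτs hls (max (max V₁ V₂) V₄)
  have hVV₁ : V₁ ≤ V := (le_max_left _ _).trans ((le_max_left _ _).trans hVN)
  have hVV₂ : V₂ ≤ V := (le_max_right _ _).trans ((le_max_left _ _).trans hVN)
  have hVV₄ : V₄ ≤ V := (le_max_right _ _).trans hVN
  have hV1 : (1 : ℝ) ≤ V := hV₁.trans hVV₁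
  have hVpos : (0 : ℝ) < V := by linarith
  have hXV := hV₄' V hVV₄
  rw [Real.rpow_zero, mul_one] at hXV
  set H : ℝ := (V : ℝ) ^ κ' with hH
  have hH0 : 0 < H := Real.rpow_pos_of_pos hVpos _
  obtain ⟨a, ha, hva, hai⟩ := exists_orthogonal_int_vec (by exact_mod_cast hu₀.ne') u v j hj hmax
    hH0 (by
      refine (hD.trans_lt (hV₁' V hVV₁)).trans_eq ?_
      rw [hH, ← Real.rpow_natCast, ← Real.rpow_mul hVpos.le])
  set p : ℝ := a 0 + ∑ i : Fin n, (a i.succ : ℝ) * ζ ^ ((i : ℕ) + 1) with hp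
  have hpV : V * p = ∑ i : Fin n, (a i.succ : ℝ) * (ζ ^ ((i : ℕ) + 1) * (V : ℝ) - v i) := by
    have hva' : (V : ℝ) * a 0 + ∑ i, (v i : ℝ) * a i.succ = 0 := by exact_mod_cast hva
    have h1 : ∑ i : Fin n, (a i.succ : ℝ) * (ζ ^ ((i : ℕ) + 1) * (V : ℝ) - v i) =
        V * ∑ i : Fin n, (a i.succ : ℝ) * ζ ^ ((i : ℕ) + 1) - ∑ i, (v i : ℝ) * a i.succ := by
      rw [Finset.mul_sum, ← Finset.sum_sub_distrib]
      exact Finset.sum_congr rfl fun i _ => by ring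
    rw [h1, hp]
    linear_combination hva'
  have hpb : |p| ≤ n * n * H * (V : ℝ) ^ (-(1 + l)) := by
    have h1 : V * |p| ≤ n * (n * H * (V : ℝ) ^ (-l)) := by
      rw [← abs_of_pos hVpos, ← abs_mul, hpV]
      refine (Finset.abs_sum_le_sum_abs _ _).trans ?_
      refine (Finset.sum_le_card_nsmul _ _ (n * H * (V : ℝ) ^ (-l)) fun i _ => ?_).trans ?_
      · rw [abs_mul]
        exact mul_le_mul (hai i) (hv i) (abs_nonneg _) (by positivity)
      · simp
    rw [neg_add, Real.rpow_add hVpos, Real.rpow_neg_one]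
    calc |p| = V * |p| / V := by field_simp
      _ ≤ n * (n * H * (V : ℝ) ^ (-l)) / V := by gcongr
      _ = _ := by field_simp
  have hl : 0 < l := hτ.trans_le hτl
  have hVl : (V : ℝ) ^ (-(1 + l)) ≤ 1 := Real.rpow_le_one_of_one_le_of_nonpos hV1 (by linarith)
  have hsum : |∑ i : Fin n, (a i.succ : ℝ) * ζ ^ ((i : ℕ) + 1)| ≤ n * H * Z := by
    refine (Finset.abs_sum_le_sum_abs _ _).trans ?_
    rw [Finset.mul_sum]
    refine Finset.sum_le_sum fun i _ => ?_
    rw [abs_mul, abs_pow]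
    exact mul_le_mul_of_nonneg_right (hai i) (by positivity)
  have hcoef : (n * n + n * Z + n) * H ≤ (V : ℝ) ^ κ := (hV₂' V hVV₂).le
  have hnH : 0 ≤ n * n * H := by positivity
  have hnH' : 0 ≤ n * H := by positivity
  have hnHZ : 0 ≤ n * H * Z := by positivity
  obtain ⟨P, hP, hPH, hpos, hPe⟩ := exists_poly_of_coeffs hζ ha (B := (V : ℝ) ^ κ) fun i => by
    refine le_trans ?_ hcoef
    refine Fin.cases ?_ (fun i => ?_) i
    · have := abs_sub_abs_le_abs_sub (a 0 : ℝ) (-∑ i : Fin n, (a i.succ : ℝ) * ζ ^ ((i : ℕ) + 1))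
      rw [sub_neg_eq_add, abs_neg, ← hp] at this
      nlinarith
    · linarith [hai i]
  refine ⟨(V : ℝ) ^ κ, hXV.le, P, hP, hPH, hpos, ?_⟩
  rw [hPe, ← hp, ← Real.rpow_mul hVpos.le,
    show κ * -((1 + l) / κ - 1) = κ + -(1 + l) by field_simp; ring, Real.rpow_add hVpos]
  refine hpb.trans (mul_le_mul_of_nonneg_right ?_ (by positivity))
  linarith

theorem whSet_subset_wSet (n : ℕ) (ζ : ℝ) : whSet n ζ ⊆ wSet n ζ := by
  rintro η ⟨X₁, h⟩ X₀
  exact ⟨max X₀ X₁, le_max_left _ _, h _ (le_max_right _ _)⟩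

theorem lamhSet_subset_lamSet (n : ℕ) (ζ : ℝ) : lamhSet n ζ ⊆ lamSet n ζ := by
  rintro η ⟨X₁, h⟩ X₀
  exact ⟨max X₀ X₁, le_max_left _ _, h _ (le_max_right _ _)⟩

/-- A uniform exponent above `1 / n` makes the right transference inequality strict. -/
theorem lt_wExp_of_mem_lamhSet {n : ℕ} (hn : 1 ≤ n) {ζ : ℝ} (hζ : Transcendental ℚ ζ)
    (hlamfin : BddAbove (lamSet n ζ)) (hwfin : BddAbove (wSet n ζ)) {τ : ℝ} (hτ : 1 < n * τ)
    (hτs : τ ∈ lamhSet n ζ) : n * lamExp n ζ + n - 1 < wExp n ζ := by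
  have hn' : (1 : ℝ) ≤ n := by exact_mod_cast hn
  have hcast : ((n - 1 : ℕ) : ℝ) = n - 1 := by rw [Nat.cast_sub hn, Nat.cast_one]
  have hτ0 : 0 < τ := by
    by_contra! h
    nlinarith
  have hτl : τ ≤ lamExp n ζ := le_csSup hlamfin (lamhSet_subset_lamSet n ζ hτs)
  obtain ⟨κ, hκ1, hκ2, hκ0⟩ : ∃ κ : ℝ, n * κ < 1 ∧ 1 - τ < κ * (n - 1 : ℕ) ∧ 0 < κ := by
    rw [hcast]
    rcases hn'.eq_or_lt with h | h
    · rw [← h] at hτ ⊢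
      exact ⟨1 / 2, by norm_num, by linarith, by norm_num⟩
    · have h1 : max ((1 - τ) / (n - 1)) 0 < 1 / n := by
        refine max_lt ?_ (by positivity)
        rw [div_lt_div_iff₀ (by linarith) (by linarith)]
        nlinarith
      obtain ⟨κ, h2, h3⟩ := exists_between h1
      rw [max_lt_iff, div_lt_iff₀ (by linarith)] at h2
      rw [lt_div_iff₀ (by linarith)] at h3
      exact ⟨κ, by linarith, h2.1, h2.2⟩
  have hw : ∀ l, l < lamExp n ζ → l ≤ κ * (1 + wExp n ζ) - 1 := by
    intro l hl
    obtain ⟨l', hlmem, hll'⟩ := exists_lt_of_lt_csSup ⟨τ, lamhSet_subset_lamSet n ζ hτs⟩ hl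
    have hmem : max τ l' ∈ lamSet n ζ := by
      rcases max_choice τ l' with h | h <;> rw [h]
      exacts [lamhSet_subset_lamSet n ζ hτs, hlmem]
    have := le_csSup hwfin (mem_wSet_of_mem_lamhSet_of_mem_lamSet hn hζ hτ (le_max_left _ _) hτs
      hmem hκ0 hκ2)
    change _ ≤ wExp n ζ at this
    rw [sub_le_iff_le_add, div_le_iff₀ hκ0] at this
    nlinarith [le_max_right τ l']
  have hle := le_of_forall_lt_imp_le_of_dense hw
  have h1 : 1 + lamExp n ζ ≤ κ * (1 + wExp n ζ) := by linarith
  have hw0 : 0 < 1 + wExp n ζ := by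
    by_contra! h
    nlinarith
  nlinarith

theorem khintchine_right_equality_uniform (n : ℕ) (hn : 1 ≤ n) (ζ : ℝ)
    (hζ : Transcendental ℚ ζ)
    (hlamfin : BddAbove (lamSet n ζ)) (hwfin : BddAbove (wSet n ζ))
    (heq : (n : ℝ) * lamExp n ζ + n - 1 = wExp n ζ) :
    lamhExp n ζ = 1 / n ∧ whExp n ζ = n := by
  
  have hn' : (1 : ℝ) ≤ n := by exact_mod_cast hn
  have hnot : ∀ τ ∈ lamhSet n ζ, n * τ ≤ 1 := fun τ hτ => by
    by_contra! h
    exact (lt_wExp_of_mem_lamhSet hn hζ hlamfin hwfin h hτ).ne heq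
  constructor
  · apply le_antisymm
    · refine csSup_le ⟨0, mem_lamhSet_of_lt ζ (by simp)⟩ fun τ hτ => ?_
      rw [le_div_iff₀ (by linarith), mul_comm]
      exact hnot τ hτ
    · refine le_of_forall_lt_imp_le_of_dense fun τ hτ => ?_
      refine le_csSup (hlamfin.mono (lamhSet_subset_lamSet n ζ)) (mem_lamhSet_of_lt ζ ?_)
      rwa [lt_div_iff₀ (by linarith), mul_comm] at hτ
  · obtain ⟨η₀, hη₀, hη₀n⟩ := exists_between (show (0 : ℝ) < n by linarith)
    apply le_antisymm
    · refine csSup_le ⟨η₀, mem_whSet_of_lt hζ hη₀ hη₀n⟩ fun η hη => ?_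
      by_contra! h
      obtain ⟨τ, hτ, hτs⟩ := exists_mem_lamhSet_of_mem_whSet hn h hη
      exact hτ.not_ge (hnot τ hτs)
    · refine le_of_forall_lt_imp_le_of_dense fun η hη => ?_
      have hmem : max η η₀ ∈ whSet n ζ :=
        mem_whSet_of_lt hζ (lt_max_of_lt_right hη₀) (max_lt hη hη₀n)
      exact (le_max_left _ _).trans
        (le_csSup (hwfin.mono (whSet_subset_wSet n ζ)) hmem)
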